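/- Let l be a positive integer and let I ⊆ ℝ be a compact interval both of whose endpoints belong to (1/l)·ℤ, and such that ℤ ∩ interior I ≠ ∅. Then the Pikhurko constant satisfies γ(ℤ, I) ≥ 1/(l + 2). Moreover, if γ(ℤ, I) = 1/(l + 2), then there exists z ∈ ℤ with I = [z − 1/l, z + 1 + 1/l]. -/

import Mathlib

open Pointwise

/-- The coefficient of asymmetry `γ(P ∈ K) = sSup {t ≥ 0 : P + t • (K - K) ⊆ K}`. -/
noncomputable def asym {E : Type*} [AddCommGroup E] [Module ℝ E] (K : Set E) (P : E) : ℝ :=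
  sSup {t : ℝ | 0 ≤ t ∧ ∀ x ∈ K - K, P + t • x ∈ K}

/-- The Pikhurko constant `γ(ℤ, K)` of a subset of `ℝ`: the supremum of the coefficients of
asymmetry over integer points of the interior of `K`. -/
noncomputable def pik (K : Set ℝ) : ℝ :=
  sSup (asym K '' ({x : ℝ | ∃ z : ℤ, x = (z : ℝ)} ∩ interior K))

theorem asym_Icc {a b p : ℝ} (hap : a < p) (hpb : p < b) :
    asym (Set.Icc a b) p = min (p - a) (b - p) / (b - a) := by
  have hL : 0 < b - a := by linarith
  have key : {t : ℝ | 0 ≤ t ∧ ∀ x ∈ Set.Icc a b - Set.Icc a b, p + t • x ∈ Set.Icc a b} =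
      Set.Icc 0 (min (p - a) (b - p) / (b - a)) := by
    ext t
    simp only [Set.mem_ofPred_eq, Set.mem_Icc, smul_eq_mul]
    refine and_congr_right fun ht => ?_
    rw [le_div_iff₀ hL, le_min_iff]
    constructor
    · intro h
      have ha : a ∈ Set.Icc a b := ⟨le_rfl, by linarith⟩
      have hb : b ∈ Set.Icc a b := ⟨by linarith, le_rfl⟩
      have h₁ := h _ (Set.sub_mem_sub ha hb)
      have h₂ := h _ (Set.sub_mem_sub hb ha)
      constructor <;> linarith
    · rintro ⟨h₁, h₂⟩ _ ⟨x, ⟨hx₁, hx₂⟩, y, ⟨hy₁, hy₂⟩, rfl⟩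
      have hu : t * (x - y) ≤ t * (b - a) := mul_le_mul_of_nonneg_left (by linarith) ht
      have hl : t * (y - x) ≤ t * (b - a) := mul_le_mul_of_nonneg_left (by linarith) ht
      constructor <;> dsimp only <;> linarith
  have h_nonneg : 0 ≤ min (p - a) (b - p) / (b - a) :=
    div_nonneg (le_min (by linarith) (by linarith)) hL.le
  rw [asym, key, csSup_Icc h_nonneg]

theorem asym_Icc_le_pik {a b : ℝ} {z : ℤ} (hz : (z : ℝ) ∈ interior (Set.Icc a b)) :
    asym (Set.Icc a b) z ≤ pik (Set.Icc a b) := by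
  refine le_csSup ⟨1, ?_⟩ ⟨z, ⟨⟨z, rfl⟩, hz⟩, rfl⟩
  rintro _ ⟨p, ⟨-, hp⟩, rfl⟩
  rw [interior_Icc] at hp
  obtain ⟨hap, hpb⟩ := hp
  rw [asym_Icc hap hpb, div_le_one (by linarith)]
  exact (min_le_left _ _).trans (by linarith)

/-- **Pikhurko.** Let `l ≥ 1` and let `I = [a, b]` be a compact interval with
endpoints in `(1/l)·ℤ` containing an integer in its interior. Then `γ(ℤ, I) ≥ 1/(l + 2)`,
with equality only for `I = [z - 1/l, z + 1 + 1/l]`, `z ∈ ℤ`. -/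
theorem stmt_5 (l : ℕ) (hl : 0 < l) (a b : ℝ) (hab : a ≤ b)
    (ha : ∃ m : ℤ, a = (m : ℝ) / l) (hb : ∃ n : ℤ, b = (n : ℝ) / l)
    (hz : ∃ z : ℤ, (z : ℝ) ∈ interior (Set.Icc a b)) :
    1 / (l + 2) ≤ pik (Set.Icc a b) ∧
    (pik (Set.Icc a b) = 1 / (l + 2) →
      ∃ z : ℤ, a = (z : ℝ) - 1 / l ∧ b = (z : ℝ) + 1 + 1 / l) := by
  obtain ⟨m, hm⟩ := ha
  obtain ⟨n, hn⟩ := hb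
  obtain ⟨z, hz⟩ := hz
  have hl' : (0 : ℝ) < l := by exact_mod_cast hl
  rw [interior_Icc] at hz
  obtain ⟨haz, hzb⟩ := hz
  set p : ℤ := round ((a + b) / 2) with hp
  have hnear := abs_le.mp (abs_sub_round ((a + b) / 2))
  have hcloser : |(a + b) / 2 - p| < (b - a) / 2 :=
    (round_le ((a + b) / 2) z).trans_lt (abs_lt.mpr ⟨by linarith, by linarith⟩)
  rw [← hp] at hnear
  rw [abs_lt] at hcloser
  have hap : a < p := by linarith
  have hpb : (p : ℝ) < b := by linarith
  have hL : 0 < b - a := by linarith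
  have hle : asym (Set.Icc a b) p ≤ pik (Set.Icc a b) :=
    asym_Icc_le_pik (by rw [interior_Icc]; exact ⟨hap, hpb⟩)
  rw [asym_Icc hap hpb] at hle
  have hma : a * l = m := by rw [hm]; field_simp
  have hnb : b * l = n := by rw [hn]; field_simp
  have hu : 1 ≤ (p - a) * l := by
    have h : (0 : ℝ) < (p * l - m : ℤ) := by
      push_cast; rw [← hma]; nlinarith
    have h' : (1 : ℝ) ≤ (p * l - m : ℤ) := by exact_mod_cast Int.cast_pos.mp h
    push_cast at h'; linarith
  have hv : 1 ≤ (b - p) * l := by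
    have h : (0 : ℝ) < (n - p * l : ℤ) := by
      push_cast; rw [← hnb]; nlinarith
    have h' : (1 : ℝ) ≤ (n - p * l : ℤ) := by exact_mod_cast Int.cast_pos.mp h
    push_cast at h'; linarith
  refine ⟨le_trans ?_ hle, fun heq => ?_⟩
  · rw [div_le_div_iff₀ (by linarith) hL]
    rcases min_cases ((p : ℝ) - a) (b - p) with ⟨h, -⟩ | ⟨h, -⟩ <;> rw [h] <;> linarith
  · rw [heq, div_le_div_iff₀ hL (by linarith)] at hle
    rcases min_cases ((p : ℝ) - a) (b - p) with ⟨h, -⟩ | ⟨h, -⟩ <;> rw [h] at hle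
    · have hinv : (p : ℝ) - a = 1 / l := by
        rw [eq_div_iff hl'.ne']; linarith
      exact ⟨p, by linarith, by linarith⟩
    · have hinv : b - (p : ℝ) = 1 / l := by
        rw [eq_div_iff hl'.ne']; linarith
      exact ⟨p - 1, by push_cast; linarith, by push_cast; linarith⟩
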